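/- arXiv:1203.5770 — 2 statements merged into one kernel-verified Lean document; each statement's English description precedes it below -/
import Mathlib

section
/- Suppose 0 < γ' ≤ γ_n ≤ γ < 1 for all n ≥ 0, let {(x_n, y_n)}_{n=0}^∞ be a solution of the system with positive initial conditions, and let {k_i}_{i=1}^∞ be a sequence of indices such that {x_{k_i}} is bounded and lim_{i→∞} w_{k_i} = M ∈ (0,∞). Then limsup_{i,n→∞} φ(k_i, n) ≤ M; that is, for every ε > 0 there exists N such that φ(k_i, n) < M + ε for all i, n ≥ N. -/
open Filter Topology

/-- The coefficient sequence extended to `ℤ` by the convention `γ₋₁ := γ₀`. -/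
noncomputable def gext (γ : ℕ → ℝ) : ℤ → ℝ := fun j => if j < 0 then γ 0 else γ j.toNat

/-- `μ(i,1) = 1` and `μ(i,k) = ∏_{j=i-1}^{i+k-3} γ_j` for `k ≥ 2`. -/
noncomputable def mu (γ : ℕ → ℝ) (i k : ℕ) : ℝ :=
  ∏ t ∈ Finset.range (k - 1), gext γ ((i : ℤ) - 1 + (t : ℤ))

/-- `φ(i,n) = ∑_{k=1}^n μ(i,k) x_{i+k}`. -/
noncomputable def phi (γ x : ℕ → ℝ) (i n : ℕ) : ℝ :=
  ∑ k ∈ Finset.Icc 1 n, mu γ i k * x (i + k)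

/-- `w_n = (γ_{n-1} + x_n)/y_n`, where `γ₋₁ := γ₀` (Nat subtraction). -/
noncomputable def wseq (γ x y : ℕ → ℝ) (n : ℕ) : ℝ := (γ (n - 1) + x n) / y n

theorem gext_sub_one (γ : ℕ → ℝ) (n : ℕ) : gext γ ((n : ℤ) - 1) = γ (n - 1) := by
  cases n with
  | zero => simp [gext]
  | succ m => simp [gext]

theorem mu_succ_succ (γ : ℕ → ℝ) (i n : ℕ) :
    mu γ i (n + 2) = mu γ i (n + 1) * γ (i + n - 1) := by
  have h : (i : ℤ) - 1 + (n : ℤ) = ((i + n : ℕ) : ℤ) - 1 := by push_cast; ring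
  simp only [mu, Nat.add_sub_cancel, show n + 2 - 1 = n + 1 from rfl, Finset.prod_range_succ]
  rw [h, gext_sub_one]

theorem mu_nonneg {γ : ℕ → ℝ} (hγ : ∀ n, 0 < γ n) (i k : ℕ) : 0 ≤ mu γ i k := by
  refine Finset.prod_nonneg fun t _ => ?_
  unfold gext
  split_ifs
  · exact (hγ _).le
  · exact (hγ _).le

/-- Along a positive solution, `w_n = x_{n+1} + γ_{n-1} w_{n+1}`. -/
theorem wseq_eq_add {γ x y : ℕ → ℝ} (hγ : ∀ n, 0 < γ n)
    (hx : ∀ n, x (n + 1) = x n / y n) (hy : ∀ n, y (n + 1) = x n + γ n * y n)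
    (hpos : ∀ n, 0 < x n ∧ 0 < y n) (n : ℕ) :
    wseq γ x y n = x (n + 1) + γ (n - 1) * wseq γ x y (n + 1) := by
  have hyn := (hpos n).2
  have hne : x n + γ n * y n ≠ 0 :=
    (add_pos (hpos n).1 (mul_pos (hγ n) hyn)).ne'
  have hw : wseq γ x y (n + 1) = 1 / y n := by
    simp only [wseq, Nat.add_sub_cancel, hx, hy]
    field_simp
    ring
  rw [hw, hx, wseq]
  ring

/-- Iterating the recurrence of `w`: `w_i = φ(i,n) + μ(i,n+1) w_{i+n}`. -/
theorem wseq_eq_phi_add {γ x y : ℕ → ℝ}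
    (hw : ∀ n, wseq γ x y n = x (n + 1) + γ (n - 1) * wseq γ x y (n + 1)) (i n : ℕ) :
    wseq γ x y i = phi γ x i n + mu γ i (n + 1) * wseq γ x y (i + n) := by
  induction n with
  | zero => simp [phi, mu]
  | succ n ih =>
    have hphi : phi γ x i (n + 1) = phi γ x i n + mu γ i (n + 1) * x (i + n + 1) :=
      Finset.sum_Icc_succ_top (by omega) _
    rw [ih, hw (i + n), hphi, mu_succ_succ, ← add_assoc i n 1]
    ring

/-- Under the standing hypotheses, if `{x_{kᵢ}}` is bounded and `w_{kᵢ} → M ∈ (0,∞)`,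
then `limsup_{i,n→∞} φ(kᵢ,n) ≤ M`: for every `ε > 0` there is `N` with
`φ(kᵢ,n) < M + ε` for all `i, n ≥ N`. -/
theorem stmt7 (γ x y : ℕ → ℝ) (γ' g : ℝ)
    (hγ' : 0 < γ') (hγlo : ∀ n, γ' ≤ γ n) (hγhi : ∀ n, γ n ≤ g) (hg : g < 1)
    (hγpos : ∀ n, 0 < γ n)
    (hx0 : 0 < x 0) (hy0 : 0 < y 0)
    (hx : ∀ n, x (n + 1) = x n / y n)
    (hy : ∀ n, y (n + 1) = x n + γ n * y n)
    (k : ℕ → ℕ) (M : ℝ) (hM : 0 < M)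
    (hkbdd : ∃ C : ℝ, ∀ i, x (k i) ≤ C)
    (hkw : Filter.Tendsto (fun i => wseq γ x y (k i)) Filter.atTop (nhds M)) :
    ∀ ε : ℝ, 0 < ε → ∃ N : ℕ, ∀ i n : ℕ, N ≤ i → N ≤ n → phi γ x (k i) n < M + ε := by
  intro ε hε
  have hpos : ∀ n, 0 < x n ∧ 0 < y n := by
    intro n
    induction n with
    | zero => exact ⟨hx0, hy0⟩
    | succ n ih =>
      rw [hx, hy]
      exact ⟨div_pos ih.1 ih.2, add_pos ih.1 (mul_pos (hγpos n) ih.2)⟩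
  obtain ⟨N, hN⟩ := eventually_atTop.1 (hkw.eventually_lt_const (lt_add_of_pos_right M hε))
  refine ⟨N, fun i n hi _ => lt_of_le_of_lt ?_ (hN i hi)⟩
  have hwpos : 0 ≤ wseq γ x y (k i + n) :=
    div_nonneg (add_pos (hγpos _) (hpos _).1).le (hpos _).2.le
  have heq := wseq_eq_phi_add (wseq_eq_add hγpos hx hy hpos) (k i) n
  have hrem := mul_nonneg (mu_nonneg hγpos (k i) (n + 1)) hwpos
  linarith
end

section
/- Let {(x_n, y_n)}_{n=0}^∞ be a solution of the system with positive initial conditions, and define w_n := (γ_{n-1} + x_n)/y_n for n ≥ 0 (with γ_{-1} := γ_0). Then the pair (x_n, w_n) satisfies x_{n+1} = x_n w_n / (x_n + γ_{n-1}) and w_{n+1} = w_n / (x_n + γ_{n-1}) for all n ≥ 0, and moreover w_{n+1} = 1 / y_n for all n ≥ 0. -/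
open Filter Topology

/-- Solutions with positive initial conditions stay positive. -/
theorem solution_pos {γ x y : ℕ → ℝ} (hγpos : ∀ n, 0 < γ n) (hx0 : 0 < x 0) (hy0 : 0 < y 0)
    (hx : ∀ n, x (n + 1) = x n / y n) (hy : ∀ n, y (n + 1) = x n + γ n * y n) (n : ℕ) :
    0 < x n ∧ 0 < y n := by
  induction n with
  | zero => exact ⟨hx0, hy0⟩
  | succ n ih =>
    rw [hx, hy]
    exact ⟨div_pos ih.1 ih.2, add_pos ih.1 (mul_pos (hγpos n) ih.2)⟩

/-- For every solution with positive initial conditions, the pair `(xₙ, wₙ)`, with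
`wₙ = (γ_{n-1} + xₙ)/yₙ` and `γ₋₁ := γ₀`, satisfies
`x_{n+1} = xₙ wₙ/(xₙ + γ_{n-1})`, `w_{n+1} = wₙ/(xₙ + γ_{n-1})`, and `w_{n+1} = 1/yₙ`. -/
theorem stmt10 (γ x y : ℕ → ℝ)
    (hγpos : ∀ n, 0 < γ n)
    (hx0 : 0 < x 0) (hy0 : 0 < y 0)
    (hx : ∀ n, x (n + 1) = x n / y n)
    (hy : ∀ n, y (n + 1) = x n + γ n * y n) :
    ∀ n : ℕ,
      x (n + 1) = x n * wseq γ x y n / (x n + γ (n - 1)) ∧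
      wseq γ x y (n + 1) = wseq γ x y n / (x n + γ (n - 1)) ∧
      wseq γ x y (n + 1) = 1 / y n := by
  intro n
  obtain ⟨hxn, hyn⟩ := solution_pos hγpos hx0 hy0 hx hy n
  have hγn := hγpos n
  have hs : x n + γ (n - 1) ≠ 0 := (add_pos hxn (hγpos _)).ne'
  have hw : wseq γ x y n / (x n + γ (n - 1)) = 1 / y n := by
    rw [wseq, add_comm (γ (n - 1))]
    field_simp
  have hw' : wseq γ x y (n + 1) = 1 / y n := by
    rw [wseq, hx, hy, Nat.add_sub_cancel]
    field_simp
    ring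
  refine ⟨?_, hw'.trans hw.symm, hw'⟩
  rw [hx, mul_div_assoc, hw, mul_one_div]
end
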